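/- arXiv:1710.11373 — 6 statements merged into one kernel-verified Lean document; each statement's English description precedes it below -/
import Mathlib

section
/- Let ρ be an N-partite density matrix and let K denote the standard product basis. Suppose a family of local unitaries U⋆ attains the infimum defining the relative entropy of discord Q(ρ). Then the following additivity relation holds: C^K(ρ) + L(ρ) = Q(ρ) + D^K(ρ), i.e., the sum of the total coherence and the entropic cost L equals the sum of the discord and the coherent dissonance. -/
open Matrix
open Kronecker
open scoped ComplexOrder

/-- Von Neumann entropy of a matrix (defined via its eigenvalues when it is Hermitian). -/
noncomputable def vN {n : Type*} [Fintype n] [DecidableEq n] (ρ : Matrix n n ℂ) : ℝ :=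
  letI := Classical.propDecidable ρ.IsHermitian
  if h : ρ.IsHermitian then ∑ i, Real.negMulLog (h.eigenvalues i) else 0

/-- Full dephasing in the standard (product) basis. -/
noncomputable def deph {n : Type*} [Fintype n] [DecidableEq n] (ρ : Matrix n n ℂ) :
    Matrix n n ℂ := Matrix.diagonal fun i => ρ i i

/-- Relative entropy of coherence in the standard (product) basis. -/
noncomputable def coh {n : Type*} [Fintype n] [DecidableEq n] (ρ : Matrix n n ℂ) : ℝ :=
  vN (deph ρ) - vN ρ

/-- The tensor product `⊗U` of a family of local unitaries, as a matrix on the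
product index type. -/
noncomputable def locU {N : ℕ} {n : Fin N → Type*} [∀ i, Fintype (n i)]
    [∀ i, DecidableEq (n i)] (U : ∀ i, Matrix.unitaryGroup (n i) ℂ) :
    Matrix (∀ i, n i) (∀ i, n i) ℂ :=
  Matrix.of fun k k' => ∏ i, (U i : Matrix (n i) (n i) ℂ) (k i) (k' i)

/-- The von Neumann entropy is invariant under conjugation by a unitary. -/
theorem vN_unitary_conj {n : Type*} [Fintype n] [DecidableEq n] (U A : Matrix n n ℂ)
    (hU : Uᴴ * U = 1) : vN (Uᴴ * A * U) = vN A := by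
  have hU' : U * Uᴴ = 1 := mul_eq_one_comm.mp hU
  by_cases hA : A.IsHermitian
  · have hB : (Uᴴ * A * U).IsHermitian := isHermitian_conjTranspose_mul_mul U hA
    have hchar : (Uᴴ * A * U).charpoly = A.charpoly := by
      rw [charpoly_mul_comm, ← mul_assoc, hU', one_mul]
    have heig : hB.eigenvalues = hA.eigenvalues :=
      (IsHermitian.eigenvalues_eq_eigenvalues_iff hB hA).mpr hchar
    simp only [vN, dif_pos hA, dif_pos hB, heig]
  · have hB : ¬ (Uᴴ * A * U).IsHermitian := by
      intro h
      have hconj := isHermitian_mul_mul_conjTranspose U h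
      have hA_eq : U * (Uᴴ * A * U) * Uᴴ = A := by
        calc U * (Uᴴ * A * U) * Uᴴ = (U * Uᴴ) * A * (U * Uᴴ) := by simp only [mul_assoc]
          _ = A := by rw [hU', one_mul, mul_one]
      exact hA (hA_eq ▸ hconj)
    simp only [vN, dif_neg hA, dif_neg hB]

/-- A tensor product of unitaries is unitary. -/
theorem conjTranspose_locU_mul_locU {N : ℕ} {n : Fin N → Type*} [∀ i, Fintype (n i)]
    [∀ i, DecidableEq (n i)] (U : ∀ i, Matrix.unitaryGroup (n i) ℂ) :
    (locU U)ᴴ * locU U = 1 := by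
  ext k k'
  have hentry (i : Fin N) :
      ∑ j, star ((U i : Matrix (n i) (n i) ℂ) j (k i)) * (U i : Matrix (n i) (n i) ℂ) j (k' i)
        = if k i = k' i then 1 else 0 := by
    have h := congrFun₂ (Unitary.coe_star_mul_self (U i)) (k i) (k' i)
    simpa only [star_eq_conjTranspose, mul_apply, conjTranspose_apply, one_apply] using h
  calc ((locU U)ᴴ * locU U) k k'
      = ∑ j : ∀ i, n i, ∏ i, star ((U i : Matrix (n i) (n i) ℂ) (j i) (k i))
          * (U i : Matrix (n i) (n i) ℂ) (j i) (k' i) := by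
        simp only [locU, mul_apply, conjTranspose_apply, of_apply, star_prod,
          Finset.prod_mul_distrib]
    _ = ∏ i, if k i = k' i then 1 else 0 := by
        simp only [← hentry, Finset.prod_univ_sum, Fintype.piFinset_univ]
    _ = (1 : Matrix (∀ i, n i) (∀ i, n i) ℂ) k k' := by
        simp [one_apply, Finset.prod_ite_zero, funext_iff]

/-- Additivity relation: if a family of local unitaries `U⋆` attains the infimum
defining the relative entropy of discord `Q(ρ)`, then
`C^K(ρ) + L(ρ) = Q(ρ) + D^K(ρ)`, where `χ = (⊗U⋆)∗ Δ((⊗U⋆) ρ (⊗U⋆)∗) (⊗U⋆)` is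
the nearest classical state, `D^K(ρ) = S(Δ(χ)) − S(χ)` and
`L(ρ) = S(Δ(χ)) − S(Δ(ρ))`. -/
theorem coherence_add_cost_eq_discord_add_dissonance
    {N : ℕ} {n : Fin N → Type*} [∀ i, Fintype (n i)] [∀ i, DecidableEq (n i)]
    [∀ i, Nonempty (n i)]
    (ρ : Matrix (∀ i, n i) (∀ i, n i) ℂ) (hρ : ρ.PosSemidef) (htr : ρ.trace = 1)
    (Ustar : ∀ i, Matrix.unitaryGroup (n i) ℂ)
    (hopt : vN (deph (locU Ustar * ρ * (locU Ustar)ᴴ))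
      = ⨅ U : ∀ i, Matrix.unitaryGroup (n i) ℂ, vN (deph (locU U * ρ * (locU U)ᴴ))) :
    let χ : Matrix (∀ i, n i) (∀ i, n i) ℂ :=
      (locU Ustar)ᴴ * deph (locU Ustar * ρ * (locU Ustar)ᴴ) * locU Ustar
    (vN (deph ρ) - vN ρ) + (vN (deph χ) - vN (deph ρ))
      = ((⨅ U : ∀ i, Matrix.unitaryGroup (n i) ℂ,
            vN (deph (locU U * ρ * (locU U)ᴴ))) - vN ρ)
        + (vN (deph χ) - vN χ) := by
  intro χ
  have hχ : vN χ = vN (deph (locU Ustar * ρ * (locU Ustar)ᴴ)) :=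
    vN_unitary_conj _ _ (conjTranspose_locU_mul_locU Ustar)
  rw [← hopt, hχ]
  ring
end

section
/- Let ρ be a bipartite density matrix on nA × nB. Then the quantum-incoherent relative entropy via subsystem A is bounded above by the difference of coherences: C^{A|B}(ρ) ≤ C(ρ) − C(ρ^B), where C(ρ) is the relative entropy of coherence of the total state and C(ρ^B) that of the reduced state on B. -/
open Matrix
open Kronecker
open scoped ComplexOrder

/-- Partial dephasing on the first (A) subsystem of a bipartite state. -/
noncomputable def dephA {nA nB : Type*} [Fintype nA] [DecidableEq nA]
    [Fintype nB] [DecidableEq nB] (ρ : Matrix (nA × nB) (nA × nB) ℂ) :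
    Matrix (nA × nB) (nA × nB) ℂ :=
  Matrix.of fun p q => if p.1 = q.1 then ρ p q else 0

/-- Reduced state on subsystem A. -/
noncomputable def redA {nA nB : Type*} [Fintype nA] [DecidableEq nA]
    [Fintype nB] [DecidableEq nB] (ρ : Matrix (nA × nB) (nA × nB) ℂ) : Matrix nA nA ℂ :=
  Matrix.of fun a a' => ∑ b, ρ (a, b) (a', b)

/-- Reduced state on subsystem B. -/
noncomputable def redB {nA nB : Type*} [Fintype nA] [DecidableEq nA]
    [Fintype nB] [DecidableEq nB] (ρ : Matrix (nA × nB) (nA × nB) ℂ) : Matrix nB nB ℂ :=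
  Matrix.of fun b b' => ∑ a, ρ (a, b) (a, b')

/-- Quantum mutual information of a bipartite state. -/
noncomputable def mi {nA nB : Type*} [Fintype nA] [DecidableEq nA]
    [Fintype nB] [DecidableEq nB] (ρ : Matrix (nA × nB) (nA × nB) ℂ) : ℝ :=
  vN (redA ρ) + vN (redB ρ) - vN ρ

/-- The action `(U ⊗ 1) ρ (U ⊗ 1)∗` of a local unitary on the A subsystem. -/
noncomputable def conjA {nA nB : Type*} [Fintype nA] [DecidableEq nA]
    [Fintype nB] [DecidableEq nB] (U : Matrix nA nA ℂ)
    (ρ : Matrix (nA × nB) (nA × nB) ℂ) : Matrix (nA × nB) (nA × nB) ℂ :=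
  (U ⊗ₖ (1 : Matrix nB nB ℂ)) * ρ * (U ⊗ₖ (1 : Matrix nB nB ℂ))ᴴ


open Filter Topology

lemma hasDerivAt_mul_log_add_mul {p q T : ℝ} (hp : 0 ≤ p) (hq : 0 ≤ q) (hT : 0 < T) :
    HasDerivAt (fun t => p * (Real.log (q + t * p) - Real.log q)) (p ^ 2 / (q + T * p)) T := by
  rcases hp.eq_or_lt with rfl | hp
  · simpa using hasDerivAt_const T (0 : ℝ)
  have hne : q + T * p ≠ 0 := by positivity
  have h := ((((hasDerivAt_id T).mul_const p).const_add q).log hne).sub_const (Real.log q)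
  refine (h.const_mul p).congr_deriv ?_
  simp only [id]
  ring

lemma continuousOn_mul_log_add_mul {p q : ℝ} (hp : 0 ≤ p) (hq : 0 ≤ q) (h : q = 0 → p = 0) :
    ContinuousOn (fun t => p * (Real.log (q + t * p) - Real.log q)) (Set.Ici 0) := by
  rcases hp.eq_or_lt with rfl | hp
  · simpa using continuousOn_const
  have hq' : 0 < q := lt_of_le_of_ne hq fun h0 => hp.ne' (h h0.symm)
  refine continuousOn_const.mul (ContinuousOn.sub (ContinuousOn.log (by fun_prop) ?_)
    continuousOn_const)
  intro t ht
  have : 0 ≤ t := ht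
  positivity

lemma tendsto_mul_log_add_mul {p : ℝ} (q : ℝ) (hp : 0 ≤ p) :
    Tendsto (fun t => p * (Real.log (q + t * p) - Real.log q) - p * Real.log t) atTop
      (𝓝 (p * (Real.log p - Real.log q))) := by
  rcases hp.eq_or_lt with rfl | hp
  · simp
  have h1 : Tendsto (fun t : ℝ => q * t⁻¹ + p) atTop (𝓝 p) := by
    simpa using (tendsto_inv_atTop_zero.const_mul q).add_const p
  have h2 := ((h1.log hp.ne').sub_const (Real.log q)).const_mul p
  refine h2.congr' ?_
  filter_upwards [eventually_gt_atTop 0, h1.eventually (lt_mem_nhds hp)] with t ht hpos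
  have : q + t * p = t * (q * t⁻¹ + p) := by field_simp
  rw [this, Real.log_mul ht.ne' hpos.ne']
  ring

/-- Comparing the integrands `p² / (q + t p)` for all `t > 0` compares relative entropies. -/
lemma sum_mul_log_sub_log_le {ι κ : Type*} [Fintype ι] [Fintype κ] {w p q : ι → ℝ}
    {r s : κ → ℝ} (hp : ∀ i, 0 ≤ p i) (hq : ∀ i, 0 ≤ q i)
    (hr : ∀ k, 0 ≤ r k) (hs : ∀ k, 0 ≤ s k)
    (hpq : ∀ i, q i = 0 → w i * p i = 0) (hrs : ∀ k, s k = 0 → r k = 0)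
    (hsum : ∑ i, w i * p i = ∑ k, r k)
    (hle : ∀ t, 0 < t →
      ∑ k, r k ^ 2 / (s k + t * r k) ≤ ∑ i, w i * (p i ^ 2 / (q i + t * p i))) :
    ∑ k, r k * (Real.log (r k) - Real.log (s k)) ≤
      ∑ i, w i * (p i * (Real.log (p i) - Real.log (q i))) := by
  set F : ℝ → ℝ := fun t =>
    ∑ i, w i * (p i * (Real.log (q i + t * p i) - Real.log (q i))) -
      ∑ k, r k * (Real.log (s k + t * r k) - Real.log (s k)) with hF
  have hd : ∀ t, 0 < t → HasDerivAt F
      (∑ i, w i * (p i ^ 2 / (q i + t * p i)) - ∑ k, r k ^ 2 / (s k + t * r k)) t := by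
    intro t ht
    exact (HasDerivAt.fun_sum fun i _ =>
      (hasDerivAt_mul_log_add_mul (hp i) (hq i) ht).const_mul (w i)).sub
      (HasDerivAt.fun_sum fun k _ => hasDerivAt_mul_log_add_mul (hr k) (hs k) ht)
  have hc : ContinuousOn F (Set.Ici 0) := by
    refine ContinuousOn.sub (continuousOn_finsetSum _ fun i _ => ?_)
      (continuousOn_finsetSum _ fun k _ => continuousOn_mul_log_add_mul (hr k) (hs k) (hrs k))
    by_cases hw : w i = 0
    · simpa [hw] using continuousOn_const
    · exact continuousOn_const.mul (continuousOn_mul_log_add_mul (hp i) (hq i)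
        fun h => (mul_eq_zero.1 (hpq i h)).resolve_left hw)
  have hm : MonotoneOn F (Set.Ici 0) := by
    refine monotoneOn_of_deriv_nonneg (convex_Ici 0) hc ?_ ?_
    · rw [interior_Ici]
      exact fun t ht => (hd t ht).differentiableAt.differentiableWithinAt
    · rw [interior_Ici]
      intro t ht
      rw [(hd t ht).deriv]
      exact sub_nonneg.2 (hle t ht)
  have h0 : F 0 = 0 := by simp [hF]
  have hlim : Tendsto F atTop (𝓝 (∑ i, w i * (p i * (Real.log (p i) - Real.log (q i))) -
      ∑ k, r k * (Real.log (r k) - Real.log (s k)))) := by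
    refine ((tendsto_finsetSum _ fun i _ =>
      (tendsto_mul_log_add_mul (q i) (hp i)).const_mul (w i)).sub
      (tendsto_finsetSum _ fun k _ => tendsto_mul_log_add_mul (s k) (hr k))).congr fun t => ?_
    simp only [hF, mul_sub, Finset.sum_sub_distrib, ← mul_assoc, ← Finset.sum_mul, hsum]
    ring
  refine sub_nonneg.1 (ge_of_tendsto hlim ?_)
  filter_upwards [eventually_ge_atTop 0] with t ht
  exact h0 ▸ hm Set.self_mem_Ici ht ht

lemma vN_eq_sum_roots {n : Type*} [Fintype n] [DecidableEq n] {A : Matrix n n ℂ}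
    (hA : A.IsHermitian) :
    vN A = (A.charpoly.roots.map fun z => Real.negMulLog z.re).sum := by
  rw [vN, dif_pos hA, hA.roots_charpoly_eq_eigenvalues, Multiset.map_map]
  simp

lemma vN_eq_sum_eigenvalues {n : Type*} [Fintype n] [DecidableEq n] {A : Matrix n n ℂ}
    (hA : A.IsHermitian) : vN A = ∑ i, Real.negMulLog (hA.eigenvalues i) := by
  rw [vN, dif_pos hA]

lemma vN_deph {n : Type*} [Fintype n] [DecidableEq n] {A : Matrix n n ℂ}
    (hA : A.IsHermitian) : vN (deph A) = ∑ i, Real.negMulLog (A i i).re := by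
  have h : (deph A).IsHermitian :=
    Matrix.isHermitian_diagonal_of_self_adjoint _ (funext fun i => hA.apply i i)
  rw [vN_eq_sum_roots h, deph, Matrix.charpoly_diagonal,
    Polynomial.roots_prod _ _ (by simp [Finset.prod_ne_zero_iff, Polynomial.X_sub_C_ne_zero])]
  simp [Multiset.bind_singleton]

section Bipartite

variable {nA nB : Type*} [Fintype nA] [DecidableEq nA] [Fintype nB] [DecidableEq nB]

lemma charpoly_dephA (ρ : Matrix (nA × nB) (nA × nB) ℂ) :
    (dephA ρ).charpoly = ∏ a, (ρ.submatrix (Prod.mk a) (Prod.mk a)).charpoly := by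
  simp only [Matrix.charpoly]
  rw [← Matrix.det_blockDiagonal, ← Matrix.det_submatrix_equiv_self (Equiv.prodComm nA nB)]
  congr 1
  ext ⟨a, b⟩ ⟨a', b'⟩ : 1
  by_cases h : a = a'
  · subst h
    simp [Matrix.charmatrix_apply, dephA, Matrix.blockDiagonal_apply, Matrix.diagonal_apply]
  · simp [dephA, Matrix.blockDiagonal_apply, h]

lemma vN_dephA {ρ : Matrix (nA × nB) (nA × nB) ℂ} (hρ : ρ.IsHermitian) :
    vN (dephA ρ) = ∑ a, vN (ρ.submatrix (Prod.mk a) (Prod.mk a)) := by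
  have h : (dephA ρ).IsHermitian := by
    ext p q
    simp only [dephA, Matrix.conjTranspose_apply, Matrix.of_apply, eq_comm (a := q.1)]
    split_ifs
    · exact hρ.apply p q
    · simp
  rw [vN_eq_sum_roots h, charpoly_dephA, Polynomial.roots_prod _ _
    (Finset.prod_ne_zero_iff.2 fun a _ => (Matrix.charpoly_monic _).ne_zero)]
  simp only [vN_eq_sum_roots (hρ.submatrix _), Multiset.map_bind, Multiset.sum_bind]
  rfl

end Bipartite

section Spectral

variable {n : Type*} [Fintype n] [DecidableEq n]

lemma Matrix.conjTranspose_mul_diagonal_mul_apply_re (M : Matrix n n ℂ) (d : n → ℝ) (j : n) :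
    ((Mᴴ * diagonal (fun i => (d i : ℂ)) * M) j j).re = ∑ i, Complex.normSq (M i j) * d i := by
  rw [mul_apply]
  simp only [mul_diagonal, conjTranspose_apply, Complex.re_sum]
  refine Finset.sum_congr rfl fun i _ => ?_
  simp [Complex.normSq_apply]
  ring

lemma Matrix.IsHermitian.spectral_decomposition {A : Matrix n n ℂ} (hA : A.IsHermitian) :
    (hA.eigenvectorUnitary : Matrix n n ℂ) * diagonal (fun i => (hA.eigenvalues i : ℂ)) *
      (hA.eigenvectorUnitary : Matrix n n ℂ)ᴴ = A :=
  hA.spectral_theorem.symm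

lemma Matrix.IsHermitian.conjTranspose_mul_mul_eigenvectorUnitary {A : Matrix n n ℂ}
    (hA : A.IsHermitian) :
    (hA.eigenvectorUnitary : Matrix n n ℂ)ᴴ * A * (hA.eigenvectorUnitary : Matrix n n ℂ) =
      diagonal (fun i => (hA.eigenvalues i : ℂ)) := by
  have h := hA.conjStarAlgAut_star_eigenvectorUnitary
  rwa [Unitary.conjStarAlgAut_star_apply] at h

lemma two_mul_mul_re_sub_le {p q t : ℝ} (hp : 0 ≤ p) (hq : 0 ≤ q) (ht : 0 < t) (y w : ℂ) :
    2 * (p * (star y * w).re) - Complex.normSq y * (q + t * p) ≤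
      Complex.normSq w * (p ^ 2 / (q + t * p)) := by
  have hc : 0 ≤ q + t * p := by positivity
  rcases hc.eq_or_lt with hc | hc
  · have : p = 0 := by
      have := mul_nonneg ht.le hp
      exact (mul_eq_zero.1 (by linarith : t * p = 0)).resolve_left ht.ne'
    rw [← hc]
    simp [this]
  · rw [← mul_div_assoc, le_div_iff₀ hc]
    simp only [Complex.normSq_apply, Complex.mul_re, Complex.star_def, Complex.conj_re,
      Complex.conj_im]
    nlinarith [sq_nonneg ((q + t * p) * y.re - p * w.re),
      sq_nonneg ((q + t * p) * y.im - p * w.im)]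

/-- For every `t`, the integrand `p² / (q + t p)` of the relative entropy decreases under a
measurement in the standard basis. -/
lemma sum_diag_sq_div_le {P Q : Matrix n n ℂ} (hP : P.PosSemidef) (hQ : Q.PosSemidef)
    {t : ℝ} (ht : 0 < t) :
    ∑ k, (P k k).re ^ 2 / ((Q k k).re + t * (P k k).re) ≤
      ∑ i, ∑ j, Complex.normSq (((hP.1.eigenvectorUnitary : Matrix n n ℂ)ᴴ *
        (hQ.1.eigenvectorUnitary : Matrix n n ℂ)) i j) * (hP.1.eigenvalues i ^ 2 /
          (hQ.1.eigenvalues j + t * hP.1.eigenvalues i)) := by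
  set x : n → ℝ := fun k => (P k k).re / ((Q k k).re + t * (P k k).re) with hx
  set X : Matrix n n ℂ := diagonal fun k => (x k : ℂ) with hX
  set U : Matrix n n ℂ := (hP.1.eigenvectorUnitary : Matrix n n ℂ)
  set V : Matrix n n ℂ := (hQ.1.eigenvectorUnitary : Matrix n n ℂ)
  set p := hP.1.eigenvalues
  set q := hQ.1.eigenvalues
  have hU : U * Uᴴ = 1 := Unitary.coe_mul_star_self hP.1.eigenvectorUnitary
  have hV : V * Vᴴ = 1 := Unitary.coe_mul_star_self hQ.1.eigenvectorUnitary
  have hXX : Xᴴ = X := by simp [hX, diagonal_conjTranspose, Pi.star_def]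
  have hUP : U * diagonal (fun i => (p i : ℂ)) * Uᴴ = P := hP.1.spectral_decomposition
  have hVQ : V * diagonal (fun i => (q i : ℂ)) * Vᴴ = Q := hQ.1.spectral_decomposition
  have hXAX : ∀ A : Matrix n n ℂ, (X * A * X).trace.re = ∑ k, x k ^ 2 * (A k k).re := by
    intro A
    simp only [trace, diag_apply, hX, mul_diagonal, diagonal_mul, Complex.re_sum]
    refine Finset.sum_congr rfl fun k _ => ?_
    simp
    ring
  set W := Uᴴ * V
  set Y := Uᴴ * X * V with hY
  have h1 : ∑ i, ∑ j, p i * (star (Y i j) * W i j).re = ∑ k, x k * (P k k).re := by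
    have : (Yᴴ * diagonal (fun i => (p i : ℂ)) * W).trace = (X * P).trace := by
      calc _ = (Vᴴ * (X * (U * diagonal (fun i => (p i : ℂ)) * Uᴴ)) * V).trace := by
            simp only [hY, W, conjTranspose_mul, conjTranspose_conjTranspose, hXX,
              Matrix.mul_assoc]
        _ = _ := by rw [hUP, trace_mul_comm, ← Matrix.mul_assoc, hV, Matrix.one_mul]
    have h := congrArg Complex.re this
    simp only [trace, diag_apply, hX, diagonal_mul, Complex.re_sum, Complex.re_ofReal_mul] at h
    rw [← h, Finset.sum_comm]
    refine Finset.sum_congr rfl fun j _ => ?_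
    rw [mul_apply]
    simp only [mul_diagonal, conjTranspose_apply, Complex.re_sum]
    refine Finset.sum_congr rfl fun i _ => ?_
    simp
    ring
  have h2 : ∑ i, ∑ j, Complex.normSq (Y i j) * p i = ∑ k, x k ^ 2 * (P k k).re := by
    rw [← hXAX, Finset.sum_comm]
    simp only [← Matrix.conjTranspose_mul_diagonal_mul_apply_re, ← Complex.re_sum]
    refine congrArg Complex.re ?_
    calc (Yᴴ * diagonal (fun i => (p i : ℂ)) * Y).trace
        = (Vᴴ * (X * (U * diagonal (fun i => (p i : ℂ)) * Uᴴ) * X) * V).trace := by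
          simp only [hY, conjTranspose_mul, conjTranspose_conjTranspose, hXX, Matrix.mul_assoc]
      _ = _ := by rw [hUP, trace_mul_comm, ← Matrix.mul_assoc, hV, Matrix.one_mul]
  have h3 : ∑ i, ∑ j, Complex.normSq (Y i j) * q j = ∑ k, x k ^ 2 * (Q k k).re := by
    rw [← hXAX]
    have hn : ∀ i j, Complex.normSq (Y i j) = Complex.normSq (Yᴴ j i) := fun i j => by
      simp [conjTranspose_apply]
    simp only [hn, ← Matrix.conjTranspose_mul_diagonal_mul_apply_re, ← Complex.re_sum]
    refine congrArg Complex.re ?_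
    calc (Yᴴᴴ * diagonal (fun i => (q i : ℂ)) * Yᴴ).trace
        = (Uᴴ * (X * (V * diagonal (fun i => (q i : ℂ)) * Vᴴ) * X) * U).trace := by
          simp only [hY, conjTranspose_mul, conjTranspose_conjTranspose, hXX, Matrix.mul_assoc]
      _ = _ := by rw [hVQ, trace_mul_comm, ← Matrix.mul_assoc, hU, Matrix.one_mul]
  calc ∑ k, (P k k).re ^ 2 / ((Q k k).re + t * (P k k).re)
      = 2 * ∑ k, x k * (P k k).re -
          (∑ k, x k ^ 2 * (Q k k).re + t * ∑ k, x k ^ 2 * (P k k).re) := by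
        simp only [Finset.mul_sum, ← Finset.sum_add_distrib, ← Finset.sum_sub_distrib]
        refine Finset.sum_congr rfl fun k _ => ?_
        simp only [hx]
        by_cases hc : (Q k k).re + t * (P k k).re = 0
        · simp [hc]
        · field_simp
          ring
    _ = ∑ i, ∑ j, (2 * (p i * (star (Y i j) * W i j).re) -
          Complex.normSq (Y i j) * (q j + t * p i)) := by
        rw [← h1, ← h2, ← h3]
        simp only [Finset.mul_sum, ← Finset.sum_add_distrib, ← Finset.sum_sub_distrib]
        refine Finset.sum_congr rfl fun i _ => Finset.sum_congr rfl fun j _ => ?_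
        ring
    _ ≤ _ := Finset.sum_le_sum fun i _ => Finset.sum_le_sum fun j _ =>
        two_mul_mul_re_sub_le (hP.eigenvalues_nonneg i) (hQ.eigenvalues_nonneg j) ht _ _

/-- The relative entropy decreases under a measurement in the standard basis. -/
lemma sum_diag_mul_log_sub_log_le {P Q : Matrix n n ℂ} (hP : P.PosSemidef) (hQ : Q.PosSemidef)
    (hd : ∀ k, (Q k k).re = 0 → (P k k).re = 0)
    (hker : ∀ j, hQ.1.eigenvalues j = 0 → (((hQ.1.eigenvectorUnitary : Matrix n n ℂ)ᴴ * P *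
      (hQ.1.eigenvectorUnitary : Matrix n n ℂ)) j j).re = 0) :
    ∑ k, (P k k).re * (Real.log (P k k).re - Real.log (Q k k).re) ≤
      ∑ i, hP.1.eigenvalues i * Real.log (hP.1.eigenvalues i) -
        ∑ j, (((hQ.1.eigenvectorUnitary : Matrix n n ℂ)ᴴ * P *
          (hQ.1.eigenvectorUnitary : Matrix n n ℂ)) j j).re *
            Real.log (hQ.1.eigenvalues j) := by
  have hle := fun t (ht : 0 < t) => sum_diag_sq_div_le hP hQ ht
  set U : Matrix n n ℂ := (hP.1.eigenvectorUnitary : Matrix n n ℂ)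
  set V : Matrix n n ℂ := (hQ.1.eigenvectorUnitary : Matrix n n ℂ)
  set p := hP.1.eigenvalues
  set q := hQ.1.eigenvalues
  have hU : U * Uᴴ = 1 := Unitary.coe_mul_star_self hP.1.eigenvectorUnitary
  have hU' : Uᴴ * U = 1 := Unitary.coe_star_mul_self hP.1.eigenvectorUnitary
  have hV : V * Vᴴ = 1 := Unitary.coe_mul_star_self hQ.1.eigenvectorUnitary
  have hUP : U * diagonal (fun i => (p i : ℂ)) * Uᴴ = P := hP.1.spectral_decomposition
  set W := Uᴴ * V with hW
  have hcol : ∀ j, ∑ i, Complex.normSq (W i j) * p i = ((Vᴴ * P * V) j j).re := by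
    intro j
    rw [← Matrix.conjTranspose_mul_diagonal_mul_apply_re, ← hUP, hW]
    simp only [conjTranspose_mul, conjTranspose_conjTranspose, Matrix.mul_assoc]
  have hrow : ∀ i, ∑ j, Complex.normSq (W i j) = 1 := by
    intro i
    have h := Matrix.conjTranspose_mul_diagonal_mul_apply_re Wᴴ (fun _ => 1) i
    have hWW : W * Wᴴ = 1 := by
      rw [hW, conjTranspose_mul, conjTranspose_conjTranspose, Matrix.mul_assoc,
        ← Matrix.mul_assoc V, hV, Matrix.one_mul, hU']
    simpa [hWW, conjTranspose_apply] using h.symm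
  have hdiag : ∀ {A : Matrix n n ℂ}, A.PosSemidef → ∀ k, 0 ≤ (A k k).re := fun hA k =>
    (Complex.le_def.1 (hA.diag_nonneg (i := k))).1
  have key := sum_mul_log_sub_log_le (ι := n × n) (κ := n)
    (w := fun a => Complex.normSq (W a.1 a.2)) (p := fun a => p a.1) (q := fun a => q a.2)
    (r := fun k => (P k k).re) (s := fun k => (Q k k).re)
    (fun a => hP.eigenvalues_nonneg a.1) (fun a => hQ.eigenvalues_nonneg a.2)
    (hdiag hP) (hdiag hQ) ?_ hd ?_ ?_
  · refine key.trans_eq ?_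
    simp only [mul_sub, Finset.sum_sub_distrib, Fintype.sum_prod_type, ← hcol, Finset.sum_mul]
    congr 1
    · simp [← Finset.sum_mul, hrow]
    · rw [Finset.sum_comm]
      simp only [mul_assoc]
  · rintro ⟨i, j⟩ hj
    have h := (hcol j).trans (hker j hj)
    exact (Finset.sum_eq_zero_iff_of_nonneg fun i _ =>
      mul_nonneg (Complex.normSq_nonneg _) (hP.eigenvalues_nonneg i)).1 h i (Finset.mem_univ i)
  · rw [Fintype.sum_prod_type_right]
    simp only [hcol, ← Complex.re_sum]
    refine congrArg Complex.re ?_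
    change (Vᴴ * P * V).trace = P.trace
    rw [trace_mul_comm, ← Matrix.mul_assoc, hV, Matrix.one_mul]
  · intro t ht
    simpa only [Fintype.sum_prod_type] using hle t ht

end Spectral

/-- Subadditivity of the (unnormalized) relative entropy of coherence. -/
lemma coh_sum_le {α n : Type*} [Fintype α] [Fintype n] [DecidableEq n]
    {σ : α → Matrix n n ℂ} (hσ : ∀ a, (σ a).PosSemidef) :
    coh (∑ a, σ a) ≤ ∑ a, coh (σ a) := by
  have hQ : (∑ a, σ a).PosSemidef := Matrix.posSemidef_sum _ fun a _ => hσ a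
  set V : Matrix n n ℂ := (hQ.1.eigenvectorUnitary : Matrix n n ℂ) with hVdef
  have hnn : ∀ {A : Matrix n n ℂ}, A.PosSemidef → ∀ k, 0 ≤ (A k k).re := fun hA k =>
    (Complex.le_def.1 (hA.diag_nonneg (i := k))).1
  have hs : ∀ k, ∑ a, (σ a k k).re = ((∑ a, σ a) k k).re := by
    simp [Matrix.sum_apply]
  have hV : ∀ j, ∑ a, ((Vᴴ * σ a * V) j j).re = hQ.1.eigenvalues j := by
    intro j
    rw [← Complex.re_sum, ← Matrix.sum_apply, ← Finset.sum_mul, ← Finset.mul_sum,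
      hQ.1.conjTranspose_mul_mul_eigenvectorUnitary]
    simp
  have key := Finset.sum_le_sum fun a (_ : a ∈ Finset.univ) =>
    sum_diag_mul_log_sub_log_le (hσ a) hQ
      (fun k hk => (Finset.sum_eq_zero_iff_of_nonneg fun a _ => hnn (hσ a) k).1
        ((hs k).trans hk) a (Finset.mem_univ a))
      (fun j hj => (Finset.sum_eq_zero_iff_of_nonneg fun a _ =>
        hnn ((hσ a).conjTranspose_mul_mul_same V) j).1
        ((hV j).trans hj) a (Finset.mem_univ a))
  have e1 : ∑ a, ∑ j, ((Vᴴ * σ a * V) j j).re * Real.log (hQ.1.eigenvalues j) =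
      ∑ j, hQ.1.eigenvalues j * Real.log (hQ.1.eigenvalues j) := by
    rw [Finset.sum_comm]
    simp only [← Finset.sum_mul, hV]
  have e2 : ∑ a, ∑ k, (σ a k k).re * Real.log ((∑ a, σ a) k k).re =
      ∑ k, ((∑ a, σ a) k k).re * Real.log ((∑ a, σ a) k k).re := by
    rw [Finset.sum_comm]
    simp only [← Finset.sum_mul, hs]
  simp only [mul_sub, Finset.sum_sub_distrib] at key
  rw [← hVdef, e1, e2] at key
  simp only [coh, vN_deph hQ.1, vN_eq_sum_eigenvalues hQ.1, vN_deph (hσ _).1,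
    vN_eq_sum_eigenvalues (hσ _).1, Real.negMulLog, neg_mul, Finset.sum_neg_distrib,
    Finset.sum_sub_distrib]
  linarith

/-- `C^{A|B}(ρ) ≤ C(ρ) − C(ρ^B)`: the quantum-incoherent relative entropy via
subsystem `A` is at most the difference between the total coherence and the
coherence of the reduced state on `B`. -/
theorem qi_coherence_le_coherence_diff
    {nA nB : Type*} [Fintype nA] [DecidableEq nA] [Nonempty nA]
    [Fintype nB] [DecidableEq nB] [Nonempty nB]
    (ρ : Matrix (nA × nB) (nA × nB) ℂ) (hρ : ρ.PosSemidef) (htr : ρ.trace = 1) :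
    vN (dephA ρ) - vN ρ ≤ coh ρ - coh (redB ρ) := by
  have hσ : ∀ a, (ρ.submatrix (Prod.mk a) (Prod.mk a)).PosSemidef := fun a => hρ.submatrix _
  have hB : redB ρ = ∑ a, ρ.submatrix (Prod.mk a) (Prod.mk a) := by
    ext b b'
    simp [redB, Matrix.sum_apply]
  have h := coh_sum_le hσ
  rw [← hB] at h
  have hd : vN (deph ρ) = ∑ a, vN (deph (ρ.submatrix (Prod.mk a) (Prod.mk a))) := by
    simp only [vN_deph hρ.1, vN_deph (hσ _).1, Fintype.sum_prod_type, Matrix.submatrix_apply]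
  simp only [coh, Finset.sum_sub_distrib, ← hd, ← vN_dephA hρ.1] at h ⊢
  linarith
end

section
/- Let ρ be a bipartite density matrix on nA × nB. Then the quantum-incoherent relative entropy satisfies the exact identity C^{A|B}(ρ) = C(ρ^A) + I(ρ) − I(Δ_A(ρ)), where I denotes the quantum mutual information and ρ^A the reduced state on A. -/
open Matrix
open Kronecker
open scoped ComplexOrder

/-- Reducing a partially dephased state to `A` gives the dephased reduced state. -/
theorem redA_dephA {nA nB : Type*} [Fintype nA] [DecidableEq nA]
    [Fintype nB] [DecidableEq nB] (ρ : Matrix (nA × nB) (nA × nB) ℂ) :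
    redA (dephA ρ) = deph (redA ρ) := by
  ext a a'
  by_cases h : a = a'
  · subst h
    simp [redA, dephA, deph]
  · simp [redA, dephA, deph, h]

/-- Partial dephasing on `A` leaves the reduced state on `B` unchanged. -/
theorem redB_dephA {nA nB : Type*} [Fintype nA] [DecidableEq nA]
    [Fintype nB] [DecidableEq nB] (ρ : Matrix (nA × nB) (nA × nB) ℂ) :
    redB (dephA ρ) = redB ρ := by
  ext b b'
  simp [redB, dephA]

/-- Exact identity: `C^{A|B}(ρ) = C(ρ^A) + I(ρ) − I(Δ_A(ρ))`. -/
theorem qi_coherence_eq_local_coherence_add_mi_loss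
    {nA nB : Type*} [Fintype nA] [DecidableEq nA] [Nonempty nA]
    [Fintype nB] [DecidableEq nB] [Nonempty nB]
    (ρ : Matrix (nA × nB) (nA × nB) ℂ) (hρ : ρ.PosSemidef) (htr : ρ.trace = 1) :
    vN (dephA ρ) - vN ρ = coh (redA ρ) + (mi ρ - mi (dephA ρ)) := by
  simp only [coh, mi, redA_dephA, redB_dephA]
  ring
end

section
/- Let ρ be a bipartite density matrix on nA × nB. Then the measurement-optimized (Zurek) one-sided discord and the local coherence of A together bound the quantum-incoherent relative entropy from below: Θ^{A|B}(ρ) + C(ρ^A) ≤ C^{A|B}(ρ). -/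
open Matrix
open Kronecker
open scoped ComplexOrder

/-- The von Neumann entropy of a density matrix is nonnegative. -/
lemma vN_nonneg {n : Type*} [Fintype n] [DecidableEq n] {ρ : Matrix n n ℂ}
    (hρ : ρ.PosSemidef) (htr : ρ.trace = 1) : 0 ≤ vN ρ := by
  have hsum : ∑ i, hρ.isHermitian.eigenvalues i = 1 := by
    have h := hρ.isHermitian.trace_eq_sum_eigenvalues
    rw [htr] at h
    exact Complex.ofReal_injective (by simpa using h.symm)
  rw [vN, dif_pos hρ.isHermitian]
  refine Finset.sum_nonneg fun i _ => Real.negMulLog_nonneg (hρ.eigenvalues_nonneg i) ?_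
  rw [← hsum]
  exact Finset.single_le_sum (fun j _ => hρ.eigenvalues_nonneg j) (Finset.mem_univ i)

/-- A dimension-dependent upper bound on the von Neumann entropy. -/
lemma vN_le_card {n : Type*} [Fintype n] [DecidableEq n] {ρ : Matrix n n ℂ}
    (hρ : ρ.PosSemidef) : vN ρ ≤ Fintype.card n := by
  rw [vN, dif_pos hρ.isHermitian]
  calc ∑ i, Real.negMulLog (hρ.isHermitian.eigenvalues i) ≤ ∑ _i : n, (1 : ℝ) := by
        refine Finset.sum_le_sum fun i _ => ?_
        have h0 := hρ.eigenvalues_nonneg i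
        have h := Real.negMulLog_le_one_sub_self h0
        linarith
    _ = Fintype.card n := by simp

section Bipartite

variable {nA nB : Type*} [Fintype nA] [DecidableEq nA] [Fintype nB] [DecidableEq nB]
  {ρ : Matrix (nA × nB) (nA × nB) ℂ}

lemma posSemidef_redA (hρ : ρ.PosSemidef) : (redA ρ).PosSemidef := by
  have h : redA ρ = ∑ b, ρ.submatrix (fun a => (a, b)) (fun a => (a, b)) := by
    ext a a'
    simp [redA, Matrix.sum_apply]
  rw [h]
  exact Matrix.posSemidef_sum _ fun b _ => hρ.submatrix _

lemma posSemidef_redB (hρ : ρ.PosSemidef) : (redB ρ).PosSemidef := by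
  have h : redB ρ = ∑ a, ρ.submatrix (fun b => (a, b)) (fun b => (a, b)) := by
    ext b b'
    simp [redB, Matrix.sum_apply]
  rw [h]
  exact Matrix.posSemidef_sum _ fun a _ => hρ.submatrix _

lemma posSemidef_dephA (hρ : ρ.PosSemidef) : (dephA ρ).PosSemidef := by
  have h : dephA ρ = ∑ a, Matrix.diagonal (fun p : nA × nB => if p.1 = a then (1 : ℂ) else 0) * ρ *
      (Matrix.diagonal fun p : nA × nB => if p.1 = a then (1 : ℂ) else 0)ᴴ := by
    ext p q
    simp [dephA, Matrix.sum_apply, Matrix.diagonal_conjTranspose, Matrix.diagonal_mul,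
      Matrix.mul_diagonal, apply_ite, eq_comm]
    split_ifs with hpq
    · exact fun h => absurd hpq h
    · exact fun h => absurd h hpq
  rw [h]
  exact Matrix.posSemidef_sum _ fun a _ => hρ.mul_mul_conjTranspose_same _

lemma trace_dephA : (dephA ρ).trace = ρ.trace := by
  simp [dephA, Matrix.trace]

lemma trace_conjA (U : Matrix.unitaryGroup nA ℂ) :
    (conjA (U : Matrix nA nA ℂ) ρ).trace = ρ.trace := by
  have hU : (U : Matrix nA nA ℂ)ᴴ * (U : Matrix nA nA ℂ) = 1 :=
    Matrix.mem_unitaryGroup_iff'.mp U.2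
  rw [conjA, Matrix.trace_mul_cycle, Matrix.conjTranspose_kronecker, ← Matrix.mul_kronecker_mul,
    hU]
  simp

lemma redA_dephA_s7 : redA (dephA ρ) = deph (redA ρ) := by
  ext a a'
  by_cases h : a = a' <;> simp [redA, dephA, deph, h]

lemma redB_dephA_s7 : redB (dephA ρ) = redB ρ := by
  ext b b'
  simp [redB, dephA]

/-- The discord of a density matrix is an infimum of a family that is bounded below. -/
lemma bddBelow_range_mi_sub_mi_dephA_conjA (hρ : ρ.PosSemidef) (htr : ρ.trace = 1) :
    BddBelow (Set.range fun U : Matrix.unitaryGroup nA ℂ =>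
      mi ρ - mi (dephA (conjA (U : Matrix nA nA ℂ) ρ))) := by
  refine ⟨mi ρ - (Fintype.card nA + Fintype.card nB), ?_⟩
  rintro _ ⟨U, rfl⟩
  have hX : (dephA (conjA (U : Matrix nA nA ℂ) ρ)).PosSemidef :=
    posSemidef_dephA (hρ.mul_mul_conjTranspose_same _)
  have h0 := vN_nonneg hX (by rw [trace_dephA, trace_conjA, htr])
  have hA := vN_le_card (posSemidef_redA hX)
  have hB := vN_le_card (posSemidef_redB hX)
  simp only [mi]
  linarith

end Bipartite

/-- `Θ^{A|B}(ρ) + C(ρ^A) ≤ C^{A|B}(ρ)`: the measurement-optimized (Zurek)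
one-sided discord plus the local coherence of `A` is bounded above by the
quantum-incoherent relative entropy. -/
theorem zurek_discord_add_local_coherence_le_qi_coherence
    {nA nB : Type*} [Fintype nA] [DecidableEq nA] [Nonempty nA]
    [Fintype nB] [DecidableEq nB] [Nonempty nB]
    (ρ : Matrix (nA × nB) (nA × nB) ℂ) (hρ : ρ.PosSemidef) (htr : ρ.trace = 1) :
    (⨅ U : Matrix.unitaryGroup nA ℂ, (mi ρ - mi (dephA (conjA (U : Matrix nA nA ℂ) ρ))))
      + coh (redA ρ) ≤ vN (dephA ρ) - vN ρ := by
  have h := ciInf_le (bddBelow_range_mi_sub_mi_dephA_conjA hρ htr) 1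
  have h1 : conjA ((1 : Matrix.unitaryGroup nA ℂ) : Matrix nA nA ℂ) ρ = ρ := by
    simp [conjA]
  simp only [h1] at h
  simp only [mi, redA_dephA_s7, redB_dephA_s7, coh] at h ⊢
  linarith
end

section
/- Let ρ be a bipartite density matrix on nA × nB. Then for the fixed product basis, the following exact identity holds: C(ρ) − C(ρ^A) − C(ρ^B) = I(ρ) − I(Δ(ρ)), i.e., the excess of the total coherence over the local coherences equals the loss of mutual information under full dephasing. -/
open Matrix
open Kronecker
open scoped ComplexOrder

theorem redA_deph {nA nB : Type*} [Fintype nA] [DecidableEq nA] [Fintype nB] [DecidableEq nB]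
    (ρ : Matrix (nA × nB) (nA × nB) ℂ) : redA (deph ρ) = deph (redA ρ) := by
  ext a a'
  by_cases h : a = a' <;> simp [redA, deph, Matrix.diagonal_apply, h]

theorem redB_deph {nA nB : Type*} [Fintype nA] [DecidableEq nA] [Fintype nB] [DecidableEq nB]
    (ρ : Matrix (nA × nB) (nA × nB) ℂ) : redB (deph ρ) = deph (redB ρ) := by
  ext b b'
  by_cases h : b = b' <;> simp [redB, deph, Matrix.diagonal_apply, h]

/-- Exact identity for the fixed product basis:
`C(ρ) − C(ρ^A) − C(ρ^B) = I(ρ) − I(Δ(ρ))`. -/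
theorem coherence_excess_eq_mi_loss
    {nA nB : Type*} [Fintype nA] [DecidableEq nA] [Nonempty nA]
    [Fintype nB] [DecidableEq nB] [Nonempty nB]
    (ρ : Matrix (nA × nB) (nA × nB) ℂ) (hρ : ρ.PosSemidef) (htr : ρ.trace = 1) :
    coh ρ - coh (redA ρ) - coh (redB ρ) = mi ρ - mi (deph ρ) := by
  simp only [coh, mi, redA_deph, redB_deph]
  ring
end

section
/- (Theorem 5) Let ρ be a tripartite density matrix on nA × nB × nR. Then the increase of quantum-incoherent coherence across the bipartite cut when R is moved from Alice's side to Bob's side is bounded by the quantum-incoherent coherence of R with the rest: C^{AR|B}(ρ) − C^{A|BR}(ρ) ≤ C^{R|AB}(ρ). -/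
open Matrix
open Kronecker
open scoped ComplexOrder

/-- Partial dephasing on the `A` subsystem of a tripartite state on `nA × nB × nR`. -/
noncomputable def dephA3 {nA nB nR : Type*}
    [Fintype nA] [DecidableEq nA] [Fintype nB] [DecidableEq nB] [Fintype nR] [DecidableEq nR]
    (ρ : Matrix (nA × nB × nR) (nA × nB × nR) ℂ) : Matrix (nA × nB × nR) (nA × nB × nR) ℂ :=
  Matrix.of fun p q => if p.1 = q.1 then ρ p q else 0

/-- Partial dephasing on the `R` subsystem of a tripartite state on `nA × nB × nR`. -/
noncomputable def dephR3 {nA nB nR : Type*}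
    [Fintype nA] [DecidableEq nA] [Fintype nB] [DecidableEq nB] [Fintype nR] [DecidableEq nR]
    (ρ : Matrix (nA × nB × nR) (nA × nB × nR) ℂ) : Matrix (nA × nB × nR) (nA × nB × nR) ℂ :=
  Matrix.of fun p q => if p.2.2 = q.2.2 then ρ p q else 0

/-- Partial dephasing on the `A` and `R` subsystems of a tripartite state on `nA × nB × nR`. -/
noncomputable def dephAR3 {nA nB nR : Type*}
    [Fintype nA] [DecidableEq nA] [Fintype nB] [DecidableEq nB] [Fintype nR] [DecidableEq nR]
    (ρ : Matrix (nA × nB × nR) (nA × nB × nR) ℂ) : Matrix (nA × nB × nR) (nA × nB × nR) ℂ :=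
  Matrix.of fun p q => if p.1 = q.1 ∧ p.2.2 = q.2.2 then ρ p q else 0

namespace Matrix

open Finset Filter Topology

variable {n κ κ' : Type*} [Fintype n] [DecidableEq n] [DecidableEq κ] [DecidableEq κ']

/-- `M = U * diagonal d * Uᴴ` with `U` unitary and `d` real. -/
structure IsEigendecomp (U : Matrix n n ℂ) (d : n → ℝ) (M : Matrix n n ℂ) : Prop where
  conjTranspose_mul : Uᴴ * U = 1
  mul_conjTranspose : U * Uᴴ = 1
  eq : M = U * diagonal (fun i => (d i : ℂ)) * Uᴴ

namespace IsEigendecomp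

variable {U M : Matrix n n ℂ} {p : n → ℝ}

theorem of_isHermitian (hM : M.IsHermitian) :
    IsEigendecomp (hM.eigenvectorUnitary : Matrix n n ℂ) hM.eigenvalues M where
  conjTranspose_mul := by
    rw [← star_eq_conjTranspose]; exact Unitary.coe_star_mul_self hM.eigenvectorUnitary
  mul_conjTranspose := by
    rw [← star_eq_conjTranspose]; exact Unitary.coe_mul_star_self hM.eigenvectorUnitary
  eq := by
    conv_lhs => rw [hM.spectral_theorem, Unitary.conjStarAlgAut_apply]
    rfl

theorem isHermitian (h : IsEigendecomp U p M) : M.IsHermitian := by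
  have hd : (diagonal fun i => (p i : ℂ))ᴴ = diagonal fun i => (p i : ℂ) := by
    rw [diagonal_conjTranspose]; congr 1; ext i; simp
  rw [IsHermitian, h.eq, Matrix.conjTranspose_mul, Matrix.conjTranspose_mul, hd,
    conjTranspose_conjTranspose, Matrix.mul_assoc]

theorem vN_eq (h : IsEigendecomp U p M) : vN M = ∑ i, Real.negMulLog (p i) := by
  have hM := h.isHermitian
  have hroots : M.charpoly.roots = Multiset.map (fun i => (p i : ℂ)) Finset.univ.val := by
    rw [h.eq, charpoly_mul_comm, ← Matrix.mul_assoc, h.conjTranspose_mul, Matrix.one_mul,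
      charpoly_diagonal, Polynomial.roots_prod]
    · simp
    · simp [Finset.prod_ne_zero_iff, Polynomial.X_sub_C_ne_zero]
  rw [hM.roots_charpoly_eq_eigenvalues] at hroots
  have key := congrArg (fun s => (s.map fun z : ℂ => Real.negMulLog z.re).sum) hroots
  simp only [Multiset.map_map, Function.comp_def, Complex.ofReal_re] at key
  rw [vN, dif_pos hM]
  exact key

theorem add_smul_one (h : IsEigendecomp U p M) (ε : ℝ) :
    IsEigendecomp U (fun i => p i + ε) (M + (ε : ℂ) • 1) where
  conjTranspose_mul := h.conjTranspose_mul
  mul_conjTranspose := h.mul_conjTranspose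
  eq := by
    have : (diagonal fun i => ((p i + ε : ℝ) : ℂ)) =
        diagonal (fun i => (p i : ℂ)) + (ε : ℂ) • (1 : Matrix n n ℂ) := by
      rw [smul_one_eq_diagonal, diagonal_add]; simp
    rw [this, Matrix.mul_add, Matrix.add_mul, ← h.eq, Matrix.mul_smul, Matrix.smul_mul,
      Matrix.mul_one, h.mul_conjTranspose]

theorem trace_eq (h : IsEigendecomp U p M) : M.trace = ∑ i, (p i : ℂ) := by
  rw [h.eq, trace_mul_comm, ← Matrix.mul_assoc, h.conjTranspose_mul, Matrix.one_mul,
    trace_diagonal]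

end IsEigendecomp

/-- The squared overlaps of the columns of `V` with the columns of `U`. -/
noncomputable def overlap (U V : Matrix n n ℂ) (j i : n) : ℝ := ‖(Vᴴ * U) j i‖ ^ 2

theorem trace_diagonal_conj (W : Matrix n n ℂ) (p f : n → ℝ) :
    (W * diagonal (fun i => (p i : ℂ)) * Wᴴ * diagonal (fun i => (f i : ℂ))).trace =
      ∑ j, ∑ i, ((‖W j i‖ ^ 2 * p i * f j : ℝ) : ℂ) := by
  simp only [trace, diag_apply, mul_diagonal]
  refine sum_congr rfl fun j _ => ?_
  rw [mul_apply, sum_mul]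
  refine sum_congr rfl fun i _ => ?_
  rw [mul_diagonal, conjTranspose_apply]
  push_cast
  rw [← Complex.mul_conj' (W j i)]
  simp only [RCLike.star_def]
  ring

theorem IsEigendecomp.trace_mul_conj {U M : Matrix n n ℂ} {p : n → ℝ} (h : IsEigendecomp U p M)
    (V : Matrix n n ℂ) (f : n → ℝ) :
    (M * (V * diagonal (fun i => (f i : ℂ)) * Vᴴ)).trace.re =
      ∑ j, ∑ i, overlap U V j i * p i * f j := by
  have := trace_diagonal_conj (Vᴴ * U) p f
  have e : (M * (V * diagonal (fun i => (f i : ℂ)) * Vᴴ)).trace =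
      (Vᴴ * U * diagonal (fun i => (p i : ℂ)) * (Vᴴ * U)ᴴ *
        diagonal (fun i => (f i : ℂ))).trace := by
    rw [h.eq, ← Matrix.mul_assoc, trace_mul_comm, Matrix.conjTranspose_mul,
      conjTranspose_conjTranspose]
    simp only [Matrix.mul_assoc]
  rw [e, this]
  simp only [← Complex.ofReal_sum, Complex.ofReal_re, overlap]

theorem sum_overlap {U V : Matrix n n ℂ} (hU : Uᴴ * U = 1) (hV : V * Vᴴ = 1) (i : n) :
    ∑ j, overlap U V j i = 1 := by
  have h : ((Vᴴ * U)ᴴ * (Vᴴ * U)) i i = 1 := by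
    rw [Matrix.conjTranspose_mul, conjTranspose_conjTranspose, Matrix.mul_assoc,
      ← Matrix.mul_assoc V, hV, Matrix.one_mul, hU, one_apply_eq]
  rw [mul_apply] at h
  simp only [conjTranspose_apply, RCLike.star_def, Complex.conj_mul'] at h
  exact_mod_cast h

/-! ### Pinching -/

/-- The pinching of `M` along the fibres of `g`: keep the entries whose indices agree under `g`. -/
def pinch (g : n → κ) (M : Matrix n n ℂ) : Matrix n n ℂ :=
  of fun a b => if g a = g b then M a b else 0

section pinch

omit [Fintype n] [DecidableEq n]

theorem pinch_apply (g : n → κ) (M : Matrix n n ℂ) (a b : n) :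
    pinch g M a b = if g a = g b then M a b else 0 := rfl

theorem pinch_pinch (g : n → κ) (M : Matrix n n ℂ) : pinch g (pinch g M) = pinch g M := by
  ext a b; simp +contextual [pinch_apply]

theorem pinch_comm (g : n → κ) (h : n → κ') (M : Matrix n n ℂ) :
    pinch g (pinch h M) = pinch h (pinch g M) := by
  ext a b; simp only [pinch_apply]; split_ifs <;> rfl

theorem pinch_add_smul_one [DecidableEq n] (g : n → κ) (M : Matrix n n ℂ) (ε : ℂ) :
    pinch g (M + ε • 1) = pinch g M + ε • 1 := by
  ext a b
  by_cases hab : a = b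
  · simp [pinch_apply, hab]
  · simp [pinch_apply, hab]

theorem pinch_conjTranspose (g : n → κ) (M : Matrix n n ℂ) : pinch g Mᴴ = (pinch g M)ᴴ := by
  ext a b
  simp only [pinch_apply, conjTranspose_apply, eq_comm (a := g a)]
  split_ifs <;> simp

theorem pinch_add (g : n → κ) (M N : Matrix n n ℂ) :
    pinch g (M + N) = pinch g M + pinch g N := by
  ext a b; simp only [pinch_apply, add_apply]; split_ifs <;> simp

theorem pinch_smul (g : n → κ) (c : ℂ) (M : Matrix n n ℂ) :
    pinch g (c • M) = c • pinch g M := by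
  ext a b; simp [pinch_apply]

end pinch

omit [DecidableEq n] in
theorem pinch_mul_pinch (g : n → κ) (M N : Matrix n n ℂ) :
    pinch g (pinch g M * N) = pinch g M * pinch g N := by
  ext a b
  simp only [pinch_apply, mul_apply]
  split_ifs with hab
  · refine sum_congr rfl fun c _ => ?_
    by_cases h : g a = g c
    · simp [← hab, h]
    · simp [h]
  · refine (sum_eq_zero fun c _ => ?_).symm
    by_cases h : g a = g c
    · simp [← h, hab]
    · simp [h]

omit [DecidableEq n] in
theorem pinch_mul_pinch' (g : n → κ) (M N : Matrix n n ℂ) :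
    pinch g (M * pinch g N) = pinch g M * pinch g N := by
  have := pinch_mul_pinch g Nᴴ Mᴴ
  rw [pinch_conjTranspose, pinch_conjTranspose, ← Matrix.conjTranspose_mul,
    ← Matrix.conjTranspose_mul, pinch_conjTranspose] at this
  exact conjTranspose_injective this

omit [DecidableEq n] in
theorem trace_pinch (g : n → κ) (M : Matrix n n ℂ) : (pinch g M).trace = M.trace := by
  simp [trace, pinch_apply]

omit [DecidableEq n] in
theorem trace_mul_pinch {g : n → κ} {M : Matrix n n ℂ} (hM : pinch g M = M) (N : Matrix n n ℂ) :
    (M * pinch g N).trace = (M * N).trace := by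
  rw [← trace_pinch g (M * N), ← hM, pinch_mul_pinch]

theorem PosSemidef.pinch {M : Matrix n n ℂ} (hM : M.PosSemidef) (g : n → κ) :
    (Matrix.pinch g M).PosSemidef := by
  have : Matrix.pinch g M = ∑ k ∈ univ.image g,
      (diagonal fun a => if g a = k then (1 : ℂ) else 0)ᴴ * M *
        diagonal fun a => if g a = k then (1 : ℂ) else 0 := by
    ext a b
    rw [Matrix.sum_apply, sum_eq_single_of_mem (g a) (mem_image_of_mem g (mem_univ a))]
    · simp [pinch_apply, diagonal_conjTranspose, eq_comm]
    · intro k _ hk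
      simp [diagonal_conjTranspose, hk.symm]
  rw [this]
  exact posSemidef_sum _ fun k _ => hM.conjTranspose_mul_mul_same _

theorem IsEigendecomp.pinch_conj_diagonal {V M : Matrix n n ℂ} {q : n → ℝ}
    (h : IsEigendecomp V q M) {g : n → κ} (hM : pinch g M = M) (f : ℝ → ℝ) :
    pinch g (V * diagonal (fun i => (f (q i) : ℂ)) * Vᴴ) =
      V * diagonal (fun i => (f (q i) : ℂ)) * Vᴴ := by
  set N := V * diagonal (fun i => (f (q i) : ℂ)) * Vᴴ with hN
  have hcomm (k : κ) : (diagonal fun a => if g a = k then (1 : ℂ) else 0) * N =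
      N * diagonal fun a => if g a = k then (1 : ℂ) else 0 := by
    set E : Matrix n n ℂ := diagonal fun a => if g a = k then (1 : ℂ) else 0 with hE
    have hEM : E * M = M * E := by
      ext a b
      rw [hE, diagonal_mul, mul_diagonal, ← hM, pinch_apply]
      by_cases hab : g a = g b <;> simp [hab]
    have hE' : (Vᴴ * E * V) * diagonal (fun i => (q i : ℂ)) =
        diagonal (fun i => (q i : ℂ)) * (Vᴴ * E * V) := by
      have hq : diagonal (fun i => (q i : ℂ)) = Vᴴ * M * V := by
        rw [h.eq]
        simp only [Matrix.mul_assoc, h.conjTranspose_mul, Matrix.mul_one]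
        rw [← Matrix.mul_assoc, h.conjTranspose_mul, Matrix.one_mul]
      calc _ = Vᴴ * E * (V * Vᴴ) * M * V := by rw [hq]; simp only [Matrix.mul_assoc]
        _ = Vᴴ * (E * M) * V := by
            rw [h.mul_conjTranspose]; simp only [Matrix.mul_assoc, Matrix.one_mul]
        _ = Vᴴ * M * (V * Vᴴ) * E * V := by
            rw [hEM, h.mul_conjTranspose]; simp only [Matrix.mul_assoc, Matrix.one_mul]
        _ = _ := by rw [hq]; simp only [Matrix.mul_assoc]
    have hF : (Vᴴ * E * V) * diagonal (fun i => (f (q i) : ℂ)) =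
        diagonal (fun i => (f (q i) : ℂ)) * (Vᴴ * E * V) := by
      ext a b
      have := congrFun (congrFun hE' a) b
      rw [diagonal_mul, mul_diagonal] at this ⊢
      by_cases hab : q a = q b
      · rw [hab, mul_comm]
      · have h0 : (Vᴴ * E * V) a b = 0 := by
          have h1 : ((q b : ℂ) - q a) * (Vᴴ * E * V) a b = 0 := by linear_combination this
          rcases mul_eq_zero.1 h1 with h2 | h2
          · exact absurd (by exact_mod_cast (sub_eq_zero.1 h2).symm) hab
          · exact h2
        simp [h0]
    calc E * N = (V * Vᴴ) * E * V * diagonal (fun i => (f (q i) : ℂ)) * Vᴴ := by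
          rw [h.mul_conjTranspose, hN]; simp only [Matrix.mul_assoc, Matrix.one_mul]
      _ = V * ((Vᴴ * E * V) * diagonal (fun i => (f (q i) : ℂ))) * Vᴴ := by
          simp only [Matrix.mul_assoc]
      _ = N * E * (V * Vᴴ) := by rw [hF, hN]; simp only [Matrix.mul_assoc]
      _ = N * E := by rw [h.mul_conjTranspose, Matrix.mul_one]
  ext a b
  have := congrFun (congrFun (hcomm (g a)) a) b
  rw [diagonal_mul, mul_diagonal] at this
  rw [pinch_apply]
  split_ifs with hab
  · rfl
  · simpa [Ne.symm hab] using this.symm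

theorem sum_overlap_log {ρ U V : Matrix n n ℂ} {p q : n → ℝ} (g : n → κ)
    (hρ : IsEigendecomp U p ρ) (hσ : IsEigendecomp V q (pinch g ρ))
    (hp : ∀ i, 0 < p i) (hq : ∀ i, 0 < q i) :
    ∑ j, ∑ i, overlap U V j i * p i * Real.log (q j / p i) = vN ρ - vN (pinch g ρ) := by
  have h1 : ∑ j, ∑ i, overlap U V j i * p i * Real.log (q j) = - vN (pinch g ρ) := by
    rw [← hρ.trace_mul_conj V fun j => Real.log (q j), trace_mul_comm,
      ← trace_mul_pinch (hσ.pinch_conj_diagonal (pinch_pinch g ρ) Real.log), hσ.vN_eq]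
    have : (V * diagonal (fun i => (Real.log (q i) : ℂ)) * Vᴴ * pinch g ρ).trace =
        (diagonal (fun i => (Real.log (q i) : ℂ)) * diagonal (fun i => (q i : ℂ))).trace := by
      conv_lhs => rw [hσ.eq]
      calc _ = (V * (diagonal (fun i => (Real.log (q i) : ℂ)) * (Vᴴ * V) *
            diagonal (fun i => (q i : ℂ)) * Vᴴ)).trace := by simp only [Matrix.mul_assoc]
        _ = _ := by
            rw [trace_mul_comm, Matrix.mul_assoc, hσ.conjTranspose_mul, Matrix.mul_one,
              Matrix.mul_one]
    rw [this, diagonal_mul_diagonal, trace_diagonal, ← sum_neg_distrib, Complex.re_sum]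
    refine sum_congr rfl fun i _ => ?_
    rw [← Complex.ofReal_mul, Complex.ofReal_re, Real.negMulLog]
    ring
  have h2 : ∑ j, ∑ i, overlap U V j i * p i * Real.log (p i) = - vN ρ := by
    rw [sum_comm, hρ.vN_eq, ← sum_neg_distrib]
    refine sum_congr rfl fun i _ => ?_
    simp_rw [mul_assoc]
    rw [← sum_mul, sum_overlap hρ.conjTranspose_mul hσ.mul_conjTranspose, Real.negMulLog]
    ring
  rw [show vN ρ - vN (pinch g ρ) = - vN (pinch g ρ) - - vN ρ by ring, ← h1, ← h2,
    ← sum_sub_distrib]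
  refine sum_congr rfl fun j _ => ?_
  rw [← sum_sub_distrib]
  refine sum_congr rfl fun i _ => ?_
  rw [Real.log_div (hq j).ne' (hp i).ne']
  ring

/-! ### Monotonicity of the resolvent form -/

/-- The concave functional whose supremum over `X` is the resolvent form of `ρ` and `σ`. -/
noncomputable def resolventFunctional (ρ σ X : Matrix n n ℂ) (t : ℝ) : ℝ :=
  2 * (Xᴴ * ρ).trace.re - (X * Xᴴ * σ).trace.re - t * (Xᴴ * X * ρ).trace.re

omit [DecidableEq n] in
theorem resolventFunctional_pinch {g : n → κ} {X : Matrix n n ℂ} (hX : pinch g X = X)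
    (ρ σ : Matrix n n ℂ) (t : ℝ) :
    resolventFunctional (pinch g ρ) (pinch g σ) X t = resolventFunctional ρ σ X t := by
  have hX' : pinch g Xᴴ = Xᴴ := by rw [pinch_conjTranspose, hX]
  have h1 : pinch g (X * Xᴴ) = X * Xᴴ := by
    conv_lhs => rw [← hX, pinch_mul_pinch, hX, hX']
  have h2 : pinch g (Xᴴ * X) = Xᴴ * X := by
    conv_lhs => rw [← hX', pinch_mul_pinch, hX', hX]
  simp only [resolventFunctional, trace_mul_pinch hX', trace_mul_pinch h1, trace_mul_pinch h2]

theorem resolventFunctional_eq {ρ σ U V : Matrix n n ℂ} {p q : n → ℝ}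
    (hρ : IsEigendecomp U p ρ) (hσ : IsEigendecomp V q σ) (Y : Matrix n n ℂ) (t : ℝ) :
    resolventFunctional ρ σ (V * Y * Uᴴ) t = ∑ j, ∑ i,
      (2 * p i * (star (Y j i) * (Vᴴ * U) j i).re - ‖Y j i‖ ^ 2 * (q j + t * p i)) := by
  have e1 : ((V * Y * Uᴴ)ᴴ * ρ).trace.re =
      ∑ j, ∑ i, p i * (star (Y j i) * (Vᴴ * U) j i).re := by
    have : ((V * Y * Uᴴ)ᴴ * ρ).trace =
        (Yᴴ * (Vᴴ * U * diagonal (fun i => (p i : ℂ)))).trace := by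
      rw [hρ.eq, Matrix.conjTranspose_mul, Matrix.conjTranspose_mul, conjTranspose_conjTranspose,
        Matrix.mul_assoc U, trace_mul_comm]
      simp only [Matrix.mul_assoc, hρ.conjTranspose_mul, Matrix.mul_one]
    rw [this, sum_comm]
    simp only [trace, diag_apply, mul_apply (M := Yᴴ), mul_diagonal, conjTranspose_apply,
      Complex.re_sum]
    refine sum_congr rfl fun i _ => sum_congr rfl fun j _ => ?_
    rw [← mul_assoc, mul_comm, Complex.re_ofReal_mul]
  have e2 : (V * Y * Uᴴ * (V * Y * Uᴴ)ᴴ * σ).trace.re = ∑ j, ∑ i, ‖Y j i‖ ^ 2 * q j := by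
    have : (V * Y * Uᴴ * (V * Y * Uᴴ)ᴴ * σ).trace =
        (Y * diagonal (fun i => ((1 : ℝ) : ℂ)) * Yᴴ * diagonal (fun i => (q i : ℂ))).trace := by
      rw [hσ.eq, Matrix.conjTranspose_mul, Matrix.conjTranspose_mul, conjTranspose_conjTranspose]
      calc _ = (V * (Y * (Uᴴ * U) * Yᴴ * (Vᴴ * V) * diagonal (fun i => (q i : ℂ)) * Vᴴ)).trace := by
            simp only [Matrix.mul_assoc]
        _ = _ := by
            rw [trace_mul_comm, Matrix.mul_assoc, hσ.conjTranspose_mul, hρ.conjTranspose_mul]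
            simp
    rw [this, trace_diagonal_conj]
    simp only [← Complex.ofReal_sum, Complex.ofReal_re, mul_one]
  have e3 : ((V * Y * Uᴴ)ᴴ * (V * Y * Uᴴ) * ρ).trace.re = ∑ j, ∑ i, ‖Y j i‖ ^ 2 * p i := by
    have : ((V * Y * Uᴴ)ᴴ * (V * Y * Uᴴ) * ρ).trace =
        (Y * diagonal (fun i => (p i : ℂ)) * Yᴴ * diagonal (fun i => ((1 : ℝ) : ℂ))).trace := by
      rw [hρ.eq, Matrix.conjTranspose_mul, Matrix.conjTranspose_mul, conjTranspose_conjTranspose]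
      calc _ = (U * (Yᴴ * (Vᴴ * V) * Y * (Uᴴ * U) * diagonal (fun i => (p i : ℂ)) * Uᴴ)).trace := by
            simp only [Matrix.mul_assoc]
        _ = _ := by
            rw [trace_mul_comm, Matrix.mul_assoc, hσ.conjTranspose_mul, hρ.conjTranspose_mul]
            simp only [Matrix.mul_one, Complex.ofReal_one, diagonal_one]
            rw [Matrix.mul_assoc Yᴴ, trace_mul_comm]
    rw [this, trace_diagonal_conj]
    simp only [← Complex.ofReal_sum, Complex.ofReal_re, mul_one]
  rw [resolventFunctional, e1, e2, e3, mul_sum, mul_sum, ← sum_sub_distrib, ← sum_sub_distrib]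
  refine sum_congr rfl fun j _ => ?_
  rw [mul_sum, mul_sum, ← sum_sub_distrib, ← sum_sub_distrib]
  refine sum_congr rfl fun i _ => ?_
  ring

theorem resolventFunctional_le {ρ σ U V : Matrix n n ℂ} {p q : n → ℝ}
    (hρ : IsEigendecomp U p ρ) (hσ : IsEigendecomp V q σ) (hp : ∀ i, 0 < p i) (hq : ∀ i, 0 < q i)
    (X : Matrix n n ℂ) {t : ℝ} (ht : 0 ≤ t) :
    resolventFunctional ρ σ X t ≤ ∑ j, ∑ i, overlap U V j i * p i / (q j / p i + t) := by
  have hX : X = V * (Vᴴ * X * U) * Uᴴ := by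
    calc X = (V * Vᴴ) * X * (U * Uᴴ) := by simp [hρ.mul_conjTranspose, hσ.mul_conjTranspose]
      _ = _ := by simp only [Matrix.mul_assoc]
  rw [hX, resolventFunctional_eq hρ hσ]
  refine sum_le_sum fun j _ => sum_le_sum fun i _ => ?_
  set y := (Vᴴ * X * U) j i
  have hs : 0 < q j + t * p i := add_pos_of_pos_of_nonneg (hq j) (mul_nonneg ht (hp i).le)
  have h1 : (star y * (Vᴴ * U) j i).re ≤ ‖y‖ * ‖(Vᴴ * U) j i‖ := by
    refine (Complex.re_le_norm _).trans ?_
    rw [norm_mul, norm_star]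
  have h2 : overlap U V j i * p i / (q j / p i + t) =
      ‖(Vᴴ * U) j i‖ ^ 2 * p i ^ 2 / (q j + t * p i) := by
    have := (hp i).ne'
    rw [overlap, div_add' _ _ _ this]
    field_simp
  rw [h2, le_div_iff₀ hs]
  have h3 := mul_le_mul_of_nonneg_left h1 (mul_pos (hp i) hs).le
  nlinarith [sq_nonneg (‖(Vᴴ * U) j i‖ * p i - ‖y‖ * (q j + t * p i))]

/-- The maximiser of the resolvent functional, in the eigenbases of `σ` and `ρ`. -/
noncomputable def resolventOpt (U V : Matrix n n ℂ) (p q : n → ℝ) (t : ℝ) : Matrix n n ℂ :=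
  of fun j i => ((p i / (q j + t * p i) : ℝ) : ℂ) * (Vᴴ * U) j i

theorem resolventFunctional_opt {ρ σ U V : Matrix n n ℂ} {p q : n → ℝ}
    (hρ : IsEigendecomp U p ρ) (hσ : IsEigendecomp V q σ) (hp : ∀ i, 0 < p i) (hq : ∀ i, 0 < q i)
    {t : ℝ} (ht : 0 ≤ t) :
    resolventFunctional ρ σ (V * resolventOpt U V p q t * Uᴴ) t =
      ∑ j, ∑ i, overlap U V j i * p i / (q j / p i + t) := by
  rw [resolventFunctional_eq hρ hσ]
  refine sum_congr rfl fun j _ => sum_congr rfl fun i _ => ?_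
  have hs : 0 < q j + t * p i := add_pos_of_pos_of_nonneg (hq j) (mul_nonneg ht (hp i).le)
  have h1 : (star (resolventOpt U V p q t j i) * (Vᴴ * U) j i).re =
      p i / (q j + t * p i) * ‖(Vᴴ * U) j i‖ ^ 2 := by
    rw [resolventOpt, of_apply, star_mul', mul_assoc]
    simp only [RCLike.star_def, Complex.conj_ofReal, Complex.conj_mul']
    rw [Complex.re_ofReal_mul]
    norm_cast
  have h2 : ‖resolventOpt U V p q t j i‖ ^ 2 =
      (p i / (q j + t * p i)) ^ 2 * ‖(Vᴴ * U) j i‖ ^ 2 := by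
    rw [resolventOpt, of_apply, norm_mul, mul_pow, Complex.norm_real, Real.norm_eq_abs, sq_abs]
  have := (hp i).ne'
  rw [h1, h2, overlap, div_add' _ _ _ this]
  field_simp
  ring

theorem sylvester_iff {ρ σ U V : Matrix n n ℂ} {p q : n → ℝ}
    (hρ : IsEigendecomp U p ρ) (hσ : IsEigendecomp V q σ) (hp : ∀ i, 0 < p i) (hq : ∀ i, 0 < q i)
    {t : ℝ} (ht : 0 ≤ t) (X : Matrix n n ℂ) :
    σ * X + (t : ℂ) • (X * ρ) = ρ ↔ X = V * resolventOpt U V p q t * Uᴴ := by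
  have conj_iff (A B : Matrix n n ℂ) : A = V * B * Uᴴ ↔ Vᴴ * A * U = B := by
    constructor
    · rintro rfl
      calc _ = (Vᴴ * V) * B * (Uᴴ * U) := by simp only [Matrix.mul_assoc]
        _ = B := by simp [hρ.conjTranspose_mul, hσ.conjTranspose_mul]
    · rintro rfl
      calc A = (V * Vᴴ) * A * (U * Uᴴ) := by simp [hρ.mul_conjTranspose, hσ.mul_conjTranspose]
        _ = _ := by simp only [Matrix.mul_assoc]
  set Y := Vᴴ * X * U with hY
  have hX : X = V * Y * Uᴴ := (conj_iff X Y).2 hY.symm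
  have hρ' : Vᴴ * ρ * U = Vᴴ * U * diagonal fun i => (p i : ℂ) := by
    rw [hρ.eq]; simp only [Matrix.mul_assoc, hρ.conjTranspose_mul, Matrix.mul_one]
  have h1 : Vᴴ * (σ * X) * U = diagonal (fun i => (q i : ℂ)) * Y := by
    rw [hσ.eq]
    calc _ = (Vᴴ * V) * diagonal (fun i => (q i : ℂ)) * (Vᴴ * X * U) := by
          simp only [Matrix.mul_assoc]
      _ = _ := by rw [hσ.conjTranspose_mul, Matrix.one_mul]
  have h2 : Vᴴ * (X * ρ) * U = Y * diagonal (fun i => (p i : ℂ)) := by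
    rw [hρ.eq]
    calc _ = (Vᴴ * X * U) * diagonal (fun i => (p i : ℂ)) * (Uᴴ * U) := by
          simp only [Matrix.mul_assoc]
      _ = _ := by rw [hρ.conjTranspose_mul, Matrix.mul_one]
  have h3 : Vᴴ * (σ * X + (t : ℂ) • (X * ρ)) * U =
      diagonal (fun i => (q i : ℂ)) * Y + (t : ℂ) • (Y * diagonal (fun i => (p i : ℂ))) := by
    rw [Matrix.mul_add, Matrix.add_mul, h1, Matrix.mul_smul, Matrix.smul_mul, h2]
  have h4 : ρ = V * (Vᴴ * U * diagonal fun i => (p i : ℂ)) * Uᴴ := (conj_iff _ _).2 hρ'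
  conv_lhs => rhs; rw [h4]
  rw [conj_iff, conj_iff, h3, ← ext_iff, ← ext_iff]
  refine forall_congr' fun j => forall_congr' fun i => ?_
  have hs : 0 < q j + t * p i := add_pos_of_pos_of_nonneg (hq j) (mul_nonneg ht (hp i).le)
  have hs' : (q j + t * p i : ℂ) ≠ 0 := by exact_mod_cast hs.ne'
  simp only [add_apply, smul_apply, diagonal_mul, mul_diagonal, resolventOpt, of_apply,
    smul_eq_mul, ← hY]
  push_cast
  rw [div_mul_eq_mul_div, eq_div_iff hs']
  constructor <;> intro h <;> linear_combination h

theorem resolvent_pinch_le {ρ σ U V U' V' : Matrix n n ℂ} {p q p' q' : n → ℝ} {g : n → κ}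
    (hρ : IsEigendecomp U p ρ) (hσ : IsEigendecomp V q σ)
    (hρ' : IsEigendecomp U' p' (pinch g ρ)) (hσ' : IsEigendecomp V' q' (pinch g σ))
    (hp : ∀ i, 0 < p i) (hq : ∀ i, 0 < q i) (hp' : ∀ i, 0 < p' i) (hq' : ∀ i, 0 < q' i)
    {t : ℝ} (ht : 0 ≤ t) :
    ∑ j, ∑ i, overlap U' V' j i * p' i / (q' j / p' i + t) ≤
      ∑ j, ∑ i, overlap U V j i * p i / (q j / p i + t) := by
  set X := V' * resolventOpt U' V' p' q' t * U'ᴴ with hX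
  have hsol := (sylvester_iff hρ' hσ' hp' hq' ht X).2 hX
  have hpin : pinch g X = X := by
    rw [hX, ← sylvester_iff hρ' hσ' hp' hq' ht, ← hX]
    have := congrArg (pinch g) hsol
    rwa [pinch_add, pinch_smul, pinch_mul_pinch, pinch_mul_pinch', pinch_pinch] at this
  rw [← resolventFunctional_opt hρ' hσ' hp' hq' ht, ← hX, resolventFunctional_pinch hpin]
  exact resolventFunctional_le hρ hσ hp hq X ht

theorem sum_mul_log_le_of_sum_div_le {ι ι' : Type*} [Fintype ι] [Fintype ι']
    {a x : ι → ℝ} {b y : ι' → ℝ} (hx : ∀ i, 0 < x i) (hy : ∀ i, 0 < y i)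
    (hab : ∑ i, a i = ∑ i, b i)
    (h : ∀ t, 0 ≤ t → ∑ i, b i / (y i + t) ≤ ∑ i, a i / (x i + t)) :
    ∑ i, a i * Real.log (x i) ≤ ∑ i, b i * Real.log (y i) := by
  let F : ℝ → ℝ := fun t =>
    ∑ i, a i * Real.log (x i + t) - ∑ i, b i * Real.log (y i + t)
  have hF (t : ℝ) (ht : 0 ≤ t) :
      HasDerivAt F (∑ i, a i / (x i + t) - ∑ i, b i / (y i + t)) t := by
    refine HasDerivAt.sub (HasDerivAt.fun_sum fun i _ => ?_) (HasDerivAt.fun_sum fun i _ => ?_)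
    · have := (((hasDerivAt_id t).const_add (x i)).log
        (add_pos_of_pos_of_nonneg (hx i) ht).ne').const_mul (a i)
      simpa [div_eq_mul_inv] using this
    · have := (((hasDerivAt_id t).const_add (y i)).log
        (add_pos_of_pos_of_nonneg (hy i) ht).ne').const_mul (b i)
      simpa [div_eq_mul_inv] using this
  have hmono : MonotoneOn F (Set.Ici 0) := by
    refine monotoneOn_of_deriv_nonneg (convex_Ici 0)
      (fun t ht => (hF t ht).continuousAt.continuousWithinAt)
      (fun t ht => (hF t (interior_subset ht)).differentiableAt.differentiableWithinAt)
      fun t ht => ?_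
    rw [(hF t (interior_subset ht)).deriv]
    exact sub_nonneg.2 (h t (interior_subset ht))
  have hlim : Tendsto F atTop (𝓝 0) := by
    have h1 (t : ℝ) : F t = ∑ i, a i * (Real.log (t + x i) - Real.log t) -
        ∑ i, b i * (Real.log (t + y i) - Real.log t) := by
      simp only [F, mul_sub, sum_sub_distrib, ← sum_mul, hab, add_comm]
      ring
    have h2 : Tendsto (fun t => ∑ i, a i * (Real.log (t + x i) - Real.log t) -
        ∑ i, b i * (Real.log (t + y i) - Real.log t)) atTop
        (𝓝 (∑ i, a i * 0 - ∑ i, b i * 0)) :=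
      (tendsto_finsetSum _ fun i _ =>
        (Real.tendsto_log_comp_add_sub_log (x i)).const_mul (a i)).sub
      (tendsto_finsetSum _ fun i _ =>
        (Real.tendsto_log_comp_add_sub_log (y i)).const_mul (b i))
    rw [funext h1]
    simpa using h2
  have h0 : F 0 ≤ 0 := ge_of_tendsto hlim <| (eventually_ge_atTop 0).mono fun t ht =>
    hmono Set.self_mem_Ici ht ht
  simpa [F] using h0

theorem IsEigendecomp.sum_overlap_mul {M U V : Matrix n n ℂ} {p : n → ℝ}
    (h : IsEigendecomp U p M) (hV : V * Vᴴ = 1) :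
    ∑ j, ∑ i, overlap U V j i * p i = M.trace.re := by
  rw [sum_comm, h.trace_eq, Complex.re_sum]
  refine sum_congr rfl fun i _ => ?_
  rw [← sum_mul, sum_overlap h.conjTranspose_mul hV, one_mul, Complex.ofReal_re]

theorem vN_pinch_pinch_add_le_of_pos {ρ U₁ U₂ U₃ U₄ : Matrix n n ℂ} {p₁ p₂ p₃ p₄ : n → ℝ}
    (g : n → κ) (h : n → κ') (h₁ : IsEigendecomp U₁ p₁ ρ) (h₂ : IsEigendecomp U₂ p₂ (pinch h ρ))
    (h₃ : IsEigendecomp U₃ p₃ (pinch g ρ)) (h₄ : IsEigendecomp U₄ p₄ (pinch g (pinch h ρ)))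
    (hp₁ : ∀ i, 0 < p₁ i) (hp₂ : ∀ i, 0 < p₂ i) (hp₃ : ∀ i, 0 < p₃ i) (hp₄ : ∀ i, 0 < p₄ i) :
    vN (pinch g (pinch h ρ)) + vN ρ ≤ vN (pinch g ρ) + vN (pinch h ρ) := by
  have h₄' : IsEigendecomp U₄ p₄ (pinch h (pinch g ρ)) := pinch_comm h g ρ ▸ h₄
  have e1 := sum_overlap_log h h₁ h₂ hp₁ hp₂
  have e2 := sum_overlap_log h h₃ h₄' hp₃ hp₄
  have key := sum_mul_log_le_of_sum_div_le
    (a := fun z : n × n => overlap U₁ U₂ z.1 z.2 * p₁ z.2) (x := fun z => p₂ z.1 / p₁ z.2)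
    (b := fun z : n × n => overlap U₃ U₄ z.1 z.2 * p₃ z.2) (y := fun z => p₄ z.1 / p₃ z.2)
    (fun z => div_pos (hp₂ _) (hp₁ _)) (fun z => div_pos (hp₄ _) (hp₃ _))
    (by
      simp only [Fintype.sum_prod_type]
      rw [h₁.sum_overlap_mul h₂.mul_conjTranspose, h₃.sum_overlap_mul h₄.mul_conjTranspose,
        trace_pinch])
    (fun t ht => by
      simp only [Fintype.sum_prod_type]
      exact resolvent_pinch_le h₁ h₂ h₃ h₄ hp₁ hp₂ hp₃ hp₄ ht)
  simp only [Fintype.sum_prod_type] at key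
  rw [e1, e2, pinch_comm h g] at key
  linarith

theorem IsEigendecomp.tendsto_vN {U M : Matrix n n ℂ} {p : n → ℝ} (h : IsEigendecomp U p M) :
    Tendsto (fun ε : ℝ => vN (M + (ε : ℂ) • 1)) (𝓝[>] 0) (𝓝 (vN M)) := by
  simp_rw [(h.add_smul_one _).vN_eq]
  have hc : Continuous fun ε : ℝ => ∑ i, Real.negMulLog (p i + ε) := by fun_prop
  simpa [h.vN_eq] using (hc.tendsto 0).mono_left nhdsWithin_le_nhds

/-- Submodularity of the von Neumann entropy under pinchings. -/
theorem PosSemidef.vN_pinch_pinch_add_le {ρ : Matrix n n ℂ} (hρ : ρ.PosSemidef)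
    (g : n → κ) (h : n → κ') :
    vN (Matrix.pinch g (Matrix.pinch h ρ)) + vN ρ ≤
      vN (Matrix.pinch g ρ) + vN (Matrix.pinch h ρ) := by
  have h₁ := hρ
  have h₂ := hρ.pinch h
  have h₃ := hρ.pinch g
  have h₄ := h₂.pinch g
  have d₁ := IsEigendecomp.of_isHermitian h₁.isHermitian
  have d₂ := IsEigendecomp.of_isHermitian h₂.isHermitian
  have d₃ := IsEigendecomp.of_isHermitian h₃.isHermitian
  have d₄ := IsEigendecomp.of_isHermitian h₄.isHermitian
  refine le_of_tendsto_of_tendsto (d₄.tendsto_vN.add d₁.tendsto_vN)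
    (d₃.tendsto_vN.add d₂.tendsto_vN) ?_
  filter_upwards [self_mem_nhdsWithin] with ε (hε : 0 < ε)
  have := vN_pinch_pinch_add_le_of_pos g h (d₁.add_smul_one ε)
    (by rw [pinch_add_smul_one]; exact d₂.add_smul_one ε)
    (by rw [pinch_add_smul_one]; exact d₃.add_smul_one ε)
    (by rw [pinch_add_smul_one, pinch_add_smul_one]; exact d₄.add_smul_one ε)
    (fun i => add_pos_of_nonneg_of_pos (h₁.eigenvalues_nonneg i) hε)
    (fun i => add_pos_of_nonneg_of_pos (h₂.eigenvalues_nonneg i) hε)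
    (fun i => add_pos_of_nonneg_of_pos (h₃.eigenvalues_nonneg i) hε)
    (fun i => add_pos_of_nonneg_of_pos (h₄.eigenvalues_nonneg i) hε)
  simpa only [pinch_add_smul_one] using this

end Matrix

/-- Theorem 5: `C^{AR|B}(ρ) − C^{A|BR}(ρ) ≤ C^{R|AB}(ρ)` for a tripartite state. -/
theorem coherence_entanglement_distribution
    {nA nB nR : Type*} [Fintype nA] [DecidableEq nA] [Nonempty nA]
    [Fintype nB] [DecidableEq nB] [Nonempty nB]
    [Fintype nR] [DecidableEq nR] [Nonempty nR]
    (ρ : Matrix (nA × nB × nR) (nA × nB × nR) ℂ) (hρ : ρ.PosSemidef) (htr : ρ.trace = 1) :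
    (vN (dephAR3 ρ) - vN ρ) - (vN (dephA3 ρ) - vN ρ) ≤ vN (dephR3 ρ) - vN ρ := by
  have key := hρ.vN_pinch_pinch_add_le (fun x : nA × nB × nR => x.1) fun x => x.2.2
  have e : dephAR3 ρ = pinch (fun x => x.1) (pinch (fun x => x.2.2) ρ) := by
    ext a b
    simp only [dephAR3, pinch_apply, of_apply, ite_and]
  rw [e]
  change _ ≤ vN (dephA3 ρ) + vN (dephR3 ρ) at key
  linarith
end
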